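/- arXiv:2310.15665 — 4 statements merged into one kernel-verified Lean document; each statement's English description precedes it below -/
import Mathlib

section
/- Let H be a real Hilbert space, let V be a closed subspace of H, and let u ∈ V and u_h ∈ H. Then ‖u − u_h‖² = (sup_{v ∈ V, ‖v‖ ≤ 1} |⟨u − u_h, v⟩|)² + (inf_{v ∈ V} ‖u_h − v‖)². (This is the abstract Hilbert-space form of the Pythagorean error decomposition: the squared error splits into the squared equilibrium residual, measured by the dual norm of the error functional on the conforming subspace V, plus the squared conformity residual, the distance from u_h to V.) -/
open scoped RealInnerProductSpace

/-- If `a ∈ V` and `x - a ⊥ V`, then the dual norm on `V` of `⟪x, ·⟫` is attained and equals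
`‖a‖`. -/
theorem isGreatest_abs_inner_of_sub_orthogonal
    {H : Type*} [NormedAddCommGroup H] [InnerProductSpace ℝ H]
    {V : Submodule ℝ H} {x a : H} (ha : a ∈ V) (h : ∀ w ∈ V, ⟪x - a, w⟫ = 0) :
    IsGreatest ((fun v => |⟪x, v⟫|) '' {v : H | v ∈ V ∧ ‖v‖ ≤ 1}) ‖a‖ := by
  have key : ∀ w ∈ V, ⟪x, w⟫ = ⟪a, w⟫ := fun w hw => by
    have := h w hw
    rwa [inner_sub_left, sub_eq_zero] at this
  refine ⟨?_, ?_⟩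
  · have hmem : ‖a‖⁻¹ • a ∈ V := V.smul_mem _ ha
    refine ⟨‖a‖⁻¹ • a, ⟨hmem, ?_⟩, ?_⟩
    · rw [norm_smul, norm_inv, norm_norm]
      exact inv_mul_le_one
    · dsimp only
      rw [key _ hmem, real_inner_smul_right, real_inner_self_eq_norm_sq]
      rcases eq_or_ne ‖a‖ 0 with h0 | h0
      · simp [h0]
      · rw [sq, inv_mul_cancel_left₀ h0, abs_norm]
  · rintro _ ⟨v, ⟨hv, hv1⟩, rfl⟩
    dsimp only
    rw [key v hv]
    exact (abs_real_inner_le_norm a v).trans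
      (mul_le_of_le_one_right (norm_nonneg a) hv1)

/-- If `p ∈ V` and `y - p ⊥ V`, then the distance from `y` to `V` is attained at `p`. -/
theorem isLeast_norm_sub_of_sub_orthogonal
    {H : Type*} [NormedAddCommGroup H] [InnerProductSpace ℝ H]
    {V : Submodule ℝ H} {y p : H} (hp : p ∈ V) (h : ∀ w ∈ V, ⟪y - p, w⟫ = 0) :
    IsLeast ((fun v => ‖y - v‖) '' (V : Set H)) ‖y - p‖ := by
  refine ⟨⟨p, hp, rfl⟩, ?_⟩
  rintro _ ⟨v, hv, rfl⟩
  have hpyth := norm_add_sq_real (y - p) (p - v)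
  rw [h _ (V.sub_mem hp hv), sub_add_sub_cancel] at hpyth
  refine (sq_le_sq₀ (norm_nonneg _) (norm_nonneg _)).1 ?_
  nlinarith [sq_nonneg ‖p - v‖]

/-- Abstract Hilbert-space Pythagorean error decomposition: for a closed subspace `V`
of a real Hilbert space `H`, `u ∈ V` and `u_h ∈ H`, the squared error splits into
the squared dual norm of the error functional on the unit ball of `V` (equilibrium
residual) plus the squared distance from `u_h` to `V` (conformity residual). -/
theorem pythagorean_error_decomposition
    {H : Type*} [NormedAddCommGroup H] [InnerProductSpace ℝ H] [CompleteSpace H]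
    (V : Submodule ℝ H) (hV : IsClosed (V : Set H)) (u uh : H) (hu : u ∈ V) :
    ‖u - uh‖ ^ 2 =
      (sSup ((fun v => |⟪u - uh, v⟫|) '' {v : H | v ∈ V ∧ ‖v‖ ≤ 1})) ^ 2 +
      (sInf ((fun v => ‖uh - v‖) '' (V : Set H))) ^ 2 := by
  have : CompleteSpace V := hV.completeSpace_coe
  have hp : V.starProjection uh ∈ V := V.starProjection_apply_mem uh
  have horth : ∀ w ∈ V, ⟪uh - V.starProjection uh, w⟫ = 0 := fun w hw =>
    V.starProjection_inner_eq_zero uh w hw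
  set p := V.starProjection uh
  have hup : u - p ∈ V := V.sub_mem hu hp
  have hres : ∀ w ∈ V, ⟪u - uh - (u - p), w⟫ = 0 := fun w hw => by
    rw [sub_sub_sub_cancel_left, ← neg_sub, inner_neg_left, horth w hw, neg_zero]
  rw [(isGreatest_abs_inner_of_sub_orthogonal hup hres).csSup_eq,
    (isLeast_norm_sub_of_sub_orthogonal hp horth).csInf_eq]
  have hpyth := norm_sub_sq_real (u - p) (uh - p)
  rw [real_inner_comm, horth _ hup, sub_sub_sub_cancel_right] at hpyth
  linarith
end

section
/- Let H be a real Hilbert space, V a closed subspace of H, u ∈ V and u_h ∈ H. Suppose R ≥ 0 and D ≥ 0 are such that |⟨u − u_h, v⟩| ≤ R‖v‖ for all v ∈ V, and there exists v₀ ∈ V with ‖u_h − v₀‖ ≤ D. Then ‖u − u_h‖² ≤ R² + D². (Abstract reliability principle: the error is bounded by the equilibrium residual bound and the conformity residual bound.) -/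
open scoped RealInnerProductSpace

/-- Abstract reliability principle: if the error functional is bounded by `R` on `V`
and `u_h` is within distance `D` of `V`, then `‖u − u_h‖² ≤ R² + D²`. -/
theorem abstract_reliability
    {H : Type*} [NormedAddCommGroup H] [InnerProductSpace ℝ H] [CompleteSpace H]
    (V : Submodule ℝ H) (hV : IsClosed (V : Set H)) (u uh : H) (hu : u ∈ V)
    (R D : ℝ) (hR : 0 ≤ R) (hD : 0 ≤ D)
    (hres : ∀ v ∈ V, |⟪u - uh, v⟫| ≤ R * ‖v‖)
    (hconf : ∃ v₀ ∈ V, ‖uh - v₀‖ ≤ D) :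
    ‖u - uh‖ ^ 2 ≤ R ^ 2 + D ^ 2 := by
  obtain ⟨v₀, hv₀, hdist⟩ := hconf
  have hinner : ⟪u - uh, u - v₀⟫ ≤ R * ‖u - v₀‖ :=
    (le_abs_self _).trans (hres _ (V.sub_mem hu hv₀))
  have hexpand := norm_sub_sq_real (u - uh) (u - v₀)
  rw [sub_sub_sub_cancel_left, norm_sub_rev] at hexpand
  have hsq : ‖uh - v₀‖ ^ 2 ≤ D ^ 2 := by gcongr
  nlinarith [sq_nonneg (R - ‖u - v₀‖)]
end

section
/- Let a < b be real numbers and let w : [a, b] → ℝ be continuously differentiable. Then w(a)² ≤ (b − a)⁻¹ ∫_a^b w(t)² dt + 2 (∫_a^b w(t)² dt)^{1/2} (∫_a^b w′(t)² dt)^{1/2}. (One-dimensional multiplicative trace inequality with explicit constants, of the type used to bound face averages of gradients in the reliability proof.) -/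
open intervalIntegral

theorem sq_intervalIntegral_mul_le {a b : ℝ} (hab : a ≤ b) {f g : ℝ → ℝ}
    (hf : ContinuousOn f (Set.Icc a b)) (hg : ContinuousOn g (Set.Icc a b)) :
    (∫ t in a..b, f t * g t) ^ 2 ≤ (∫ t in a..b, f t ^ 2) * ∫ t in a..b, g t ^ 2 := by
  have hff : IntervalIntegrable (fun t => f t ^ 2) MeasureTheory.volume a b :=
    (hf.pow 2).intervalIntegrable_of_Icc hab
  have hgg : IntervalIntegrable (fun t => g t ^ 2) MeasureTheory.volume a b :=
    (hg.pow 2).intervalIntegrable_of_Icc hab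
  have hfg : IntervalIntegrable (fun t => f t * g t) MeasureTheory.volume a b :=
    (hf.mul hg).intervalIntegrable_of_Icc hab
  have hquad : ∀ x : ℝ, 0 ≤ (∫ t in a..b, f t ^ 2) * (x * x)
      + (2 * ∫ t in a..b, f t * g t) * x + ∫ t in a..b, g t ^ 2 := by
    intro x
    calc (0 : ℝ) ≤ ∫ t in a..b, (f t * x + g t) ^ 2 :=
          integral_nonneg hab fun t _ => sq_nonneg _
      _ = ∫ t in a..b, (f t ^ 2 * (x * x) + f t * g t * (2 * x) + g t ^ 2) := by
          congr 1; ext t; ring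
      _ = _ := by
          rw [integral_add ((hff.mul_const _).add (hfg.mul_const _)) hgg,
            integral_add (hff.mul_const _) (hfg.mul_const _), integral_mul_const,
            integral_mul_const]
          ring
  have h := discrim_le_zero hquad
  rw [discrim] at h
  linarith

/-- One-dimensional multiplicative trace inequality with explicit constants:
for `w` continuously differentiable on `[a,b]` with derivative `w'`,
`w(a)² ≤ (b−a)⁻¹ ∫_a^b w² + 2 (∫_a^b w²)^{1/2} (∫_a^b w'²)^{1/2}`. -/
theorem one_dimensional_trace_inequality
    (a b : ℝ) (hab : a < b) (w w' : ℝ → ℝ)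
    (hderiv : ∀ t ∈ Set.Icc a b, HasDerivWithinAt w (w' t) (Set.Icc a b) t)
    (hcont : ContinuousOn w' (Set.Icc a b)) :
    w a ^ 2 ≤ (b - a)⁻¹ * (∫ t in a..b, w t ^ 2)
      + 2 * Real.sqrt (∫ t in a..b, w t ^ 2) * Real.sqrt (∫ t in a..b, w' t ^ 2) := by
  have hw : ContinuousOn w (Set.Icc a b) := fun t ht => (hderiv t ht).continuousWithinAt
  have hwt : ContinuousOn (fun t => (b - t) * w t ^ 2) (Set.Icc a b) := by fun_prop
  have hww : IntervalIntegrable (fun t => w t ^ 2) MeasureTheory.volume a b :=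
    (hw.pow 2).intervalIntegrable_of_Icc hab.le
  have habs : IntervalIntegrable (fun t => |w t| * |w' t|) MeasureTheory.volume a b :=
    (hw.abs.mul hcont.abs).intervalIntegrable_of_Icc hab.le
  have hint : IntervalIntegrable (fun t => -w t ^ 2 + (b - t) * (2 * w t * w' t))
      MeasureTheory.volume a b :=
    ContinuousOn.intervalIntegrable_of_Icc hab.le (by fun_prop)
  have hftc : ∫ t in a..b, (-w t ^ 2 + (b - t) * (2 * w t * w' t)) = -((b - a) * w a ^ 2) := by
    rw [integral_eq_sub_of_hasDerivAt_of_le hab.le hwt (fun t ht => ?_) hint]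
    · ring
    · have hd := (hderiv t (Set.Ioo_subset_Icc_self ht)).hasDerivAt (Icc_mem_nhds ht.1 ht.2)
      exact (((hasDerivAt_id t).const_sub b).mul (hd.pow 2)).congr_deriv (by simp)
  have hbound : (b - a) * w a ^ 2 ≤
      (∫ t in a..b, w t ^ 2) + (2 * (b - a)) * ∫ t in a..b, |w t| * |w' t| := by
    rw [← neg_eq_iff_eq_neg.mpr hftc, ← integral_neg, ← integral_const_mul,
      ← integral_add hww (habs.const_mul _)]
    refine integral_mono_on hab.le hint.neg (hww.add (habs.const_mul _)) fun t ht => ?_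
    have h₁ : -(w t * w' t) ≤ |w t| * |w' t| := abs_mul (w t) (w' t) ▸ neg_le_abs _
    have h₂ : 0 ≤ |w t| * |w' t| := by positivity
    nlinarith [mul_le_mul_of_nonneg_left h₁ (sub_nonneg.2 ht.2),
      mul_le_mul_of_nonneg_right (sub_le_sub_left ht.1 b) h₂]
  have hcs : ∫ t in a..b, |w t| * |w' t| ≤
      Real.sqrt (∫ t in a..b, w t ^ 2) * Real.sqrt (∫ t in a..b, w' t ^ 2) := by
    rw [← Real.sqrt_mul (integral_nonneg hab.le fun t _ => sq_nonneg _)]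
    refine Real.le_sqrt_of_sq_le ?_
    simpa only [sq_abs] using sq_intervalIntegral_mul_le hab.le hw.abs hcont.abs
  have hpos : 0 < b - a := sub_pos.2 hab
  calc w a ^ 2 = (b - a)⁻¹ * ((b - a) * w a ^ 2) := by field_simp
    _ ≤ (b - a)⁻¹ * ((∫ t in a..b, w t ^ 2) + (2 * (b - a)) * ∫ t in a..b, |w t| * |w' t|) := by
        gcongr
    _ = (b - a)⁻¹ * (∫ t in a..b, w t ^ 2) + 2 * ∫ t in a..b, |w t| * |w' t| := by
        field_simp
    _ ≤ _ := by rw [mul_assoc 2]; gcongr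
end

section
/- Let d ≥ 1 and let T ⊂ ℝ^d be the standard (unit) simplex. Let ℓ and L be integers with 2 ≤ ℓ ≤ L. There exists a constant C > 0, depending only on d, ℓ and L, such that for every ε ∈ (0,1], every α ∈ {0, 1}, and every polynomial function w on ℝ^d of total degree at most L, the L²(T)-orthogonal projection Π_ℓ w of w onto the space of polynomial functions of total degree at most ℓ satisfies ε² ‖D²(w − Π_ℓ w)‖²_{L²(T)} + α ‖∇(w − Π_ℓ w)‖²_{L²(T)} ≤ C · min over polynomials v of degree at most ℓ of ( ε² ‖D²(w − v)‖²_{L²(T)} + α ‖∇(w − v)‖²_{L²(T)} ). (Quasi-optimality of the L² projection with respect to the energy seminorm |||·|||, uniformly in the singular perturbation parameter ε and in α.) -/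
open MeasureTheory MvPolynomial

/-- The standard (unit) simplex in `ℝ^d`. -/
def stdSimplex' (d : ℕ) : Set (EuclideanSpace ℝ (Fin d)) :=
  {x | (∀ i, 0 ≤ x i) ∧ ∑ i, x i ≤ 1}

/-- A linear map on a finite-dimensional space whose kernel contains that of another linear map
is bounded in norm by a multiple of the latter. -/
theorem LinearMap.exists_norm_le_of_ker_le {V E F : Type*} [AddCommGroup V] [Module ℝ V]
    [FiniteDimensional ℝ V] [NormedAddCommGroup E] [NormedSpace ℝ E] [NormedAddCommGroup F]
    [NormedSpace ℝ F] (f : V →ₗ[ℝ] E) (g : V →ₗ[ℝ] F) (h : ∀ v, f v = 0 → g v = 0) :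
    ∃ C : ℝ, 0 < C ∧ ∀ v, ‖g v‖ ≤ C * ‖f v‖ := by
  obtain ⟨s, hs⟩ := f.rangeRestrict.exists_rightInverse_of_surjective f.range_rangeRestrict
  obtain ⟨C, hC, hb⟩ := (LinearMap.toContinuousLinearMap (g ∘ₗ s)).bound
  refine ⟨C, hC, fun v => ?_⟩
  have hfs : f (s (f.rangeRestrict v)) = f v :=
    congrArg Subtype.val (LinearMap.congr_fun hs (f.rangeRestrict v))
  have hg : g (s (f.rangeRestrict v)) = g v := by
    rw [← sub_eq_zero, ← map_sub]
    exact h _ (by rw [map_sub, hfs, sub_self])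
  simpa [hg] using hb (f.rangeRestrict v)

/-- Evaluation of a polynomial as a function on Euclidean space. -/
noncomputable def polyFun {d : ℕ} (u : MvPolynomial (Fin d) ℝ) (y : EuclideanSpace ℝ (Fin d)) : ℝ :=
  eval (fun i => y i) u

theorem analyticOnNhd_polyFun {d : ℕ} (u : MvPolynomial (Fin d) ℝ) :
    AnalyticOnNhd ℝ (polyFun u) Set.univ := by
  let f (i : Fin d) : EuclideanSpace ℝ (Fin d) →L[ℝ] ℝ := EuclideanSpace.proj i
  exact AnalyticOnNhd.eval_continuousLinearMap' f u

theorem contDiff_polyFun {d : ℕ} (u : MvPolynomial (Fin d) ℝ) {n : WithTop ℕ∞} :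
    ContDiff ℝ n (polyFun u) :=
  (analyticOnNhd_polyFun u).contDiff

theorem polyFun_add {d : ℕ} (u v : MvPolynomial (Fin d) ℝ) :
    polyFun (u + v) = polyFun u + polyFun v := by
  funext y
  simp [polyFun]

theorem polyFun_smul {d : ℕ} (c : ℝ) (u : MvPolynomial (Fin d) ℝ) :
    polyFun (c • u) = c • polyFun u := by
  funext y
  simp [polyFun]

theorem eq_of_polyFun_eq {d : ℕ} {u v : MvPolynomial (Fin d) ℝ} (h : polyFun u = polyFun v) :
    u = v :=
  MvPolynomial.funext fun x => congrFun h (WithLp.toLp 2 x)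

theorem isCompact_stdSimplex' (d : ℕ) : IsCompact (stdSimplex' d) := by
  have hc : ∀ i : Fin d, Continuous fun x : EuclideanSpace ℝ (Fin d) => x i := by fun_prop
  refine Metric.isCompact_of_isClosed_isBounded ?_ ?_
  · have h : stdSimplex' d = (⋂ i, {x | 0 ≤ x i}) ∩ {x | ∑ i, x i ≤ 1} := by
      ext x
      simp [stdSimplex']
    rw [h]
    exact (isClosed_iInter fun i => isClosed_le continuous_const (hc i)).inter
      (isClosed_le (continuous_finsetSum _ fun i _ => hc i) continuous_const)
  · refine isBounded_iff_forall_norm_le.2 ⟨1, fun x hx => ?_⟩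
    rw [EuclideanSpace.norm_eq, Real.sqrt_le_one]
    refine le_trans (Finset.sum_le_sum fun i _ => ?_) hx.2
    have h0 := hx.1 i
    have h1 : x i ≤ 1 :=
      (Finset.single_le_sum (fun j _ => hx.1 j) (Finset.mem_univ i)).trans hx.2
    rw [Real.norm_eq_abs, sq_abs]
    nlinarith

instance isFiniteMeasure_restrict_stdSimplex' (d : ℕ) :
    IsFiniteMeasure (volume.restrict (stdSimplex' d)) :=
  isFiniteMeasure_restrict.2 (isCompact_stdSimplex' d).measure_lt_top.ne

theorem Continuous.memLp_stdSimplex' {d : ℕ} {G : Type*} [NormedAddCommGroup G]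
    {F : EuclideanSpace ℝ (Fin d) → G} (hF : Continuous F) (p : ENNReal) :
    MemLp F p (volume.restrict (stdSimplex' d)) := by
  have hT := isCompact_stdSimplex' d
  obtain ⟨C, hC⟩ := hT.exists_bound_of_continuousOn hF.continuousOn
  exact MemLp.of_bound (hF.continuousOn.aestronglyMeasurable_of_isCompact hT hT.measurableSet) C
    ((ae_restrict_iff' hT.measurableSet).2 (Filter.Eventually.of_forall hC))

/-- An analytic function vanishing almost everywhere on the simplex vanishes identically. -/
theorem AnalyticOnNhd.eq_zero_of_ae_stdSimplex' {d : ℕ} {G : Type*} [NormedAddCommGroup G]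
    [NormedSpace ℝ G] {F : EuclideanSpace ℝ (Fin d) → G} (hF : AnalyticOnNhd ℝ F Set.univ)
    (h : F =ᵐ[volume.restrict (stdSimplex' d)] 0) : F = 0 := by
  have hc : ∀ i : Fin d, Continuous fun x : EuclideanSpace ℝ (Fin d) => x i := by fun_prop
  let U : Set (EuclideanSpace ℝ (Fin d)) := (⋂ i, {x | 0 < x i}) ∩ {x | ∑ i, x i < 1}
  have hU : IsOpen U :=
    (isOpen_iInter_of_finite fun i => isOpen_lt continuous_const (hc i)).inter
      (isOpen_lt (continuous_finsetSum _ fun i _ => hc i) continuous_const)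
  have hUT : U ⊆ stdSimplex' d := fun x hx =>
    ⟨fun i => (Set.mem_iInter.1 hx.1 i).le, hx.2.le⟩
  have hmem : (WithLp.toLp 2 fun _ => 1 / ((d : ℝ) + 1)) ∈ U := by
    refine ⟨Set.mem_iInter.2 fun i => ?_, ?_⟩
    · simp only [Set.mem_ofPred_eq]
      positivity
    · simp only [Set.mem_ofPred_eq, Finset.sum_const, Finset.card_univ, Fintype.card_fin,
        nsmul_eq_mul]
      rw [mul_one_div, div_lt_one (by positivity)]
      linarith
  have hEq : Set.EqOn F 0 U :=
    Measure.eqOn_open_of_ae_eq (ae_restrict_of_ae_restrict_of_subset hUT h) hU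
      (hF.continuousOn.mono (Set.subset_univ _)) continuousOn_const
  exact hF.eq_of_eventuallyEq analyticOnNhd_const (hEq.eventuallyEq_of_mem (hU.mem_nhds hmem))

theorem integral_polyFun_mul_add {d : ℕ} (u v q : MvPolynomial (Fin d) ℝ) :
    ∫ x in stdSimplex' d, polyFun (u + v) x * polyFun q x =
      (∫ x in stdSimplex' d, polyFun u x * polyFun q x) +
        ∫ x in stdSimplex' d, polyFun v x * polyFun q x := by
  have hi (u : MvPolynomial (Fin d) ℝ) :
      Integrable (fun x => polyFun u x * polyFun q x) (volume.restrict (stdSimplex' d)) :=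
    memLp_one_iff_integrable.1 (((contDiff_polyFun (n := 0) u).continuous.mul
      (contDiff_polyFun (n := 0) q).continuous).memLp_stdSimplex' 1)
  rw [← integral_add (hi u) (hi v)]
  simp [polyFun_add, add_mul]

/-- The polynomials orthogonal in `L²` of the simplex to all polynomials of degree at most `ℓ`. -/
noncomputable def simplexOrthogonal (d ℓ : ℕ) : Submodule ℝ (MvPolynomial (Fin d) ℝ) where
  carrier := {r | ∀ q : MvPolynomial (Fin d) ℝ, q.totalDegree ≤ ℓ →
    ∫ x in stdSimplex' d, polyFun r x * polyFun q x = 0}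
  zero_mem' q _ := by simp [polyFun]
  add_mem' {u v} hu hv q hq := by rw [integral_polyFun_mul_add, hu q hq, hv q hq, add_zero]
  smul_mem' c u hu q hq := by
    simp only [polyFun_smul, Pi.smul_apply, smul_eq_mul, mul_assoc]
    rw [integral_const_mul, hu q hq, mul_zero]

theorem eq_zero_of_mem_simplexOrthogonal {d ℓ : ℕ} {r : MvPolynomial (Fin d) ℝ}
    (hr : r ∈ simplexOrthogonal d ℓ) (hdeg : r.totalDegree ≤ ℓ) : r = 0 := by
  have hc : Continuous fun x => polyFun r x * polyFun r x :=
    (contDiff_polyFun (n := 0) r).continuous.mul (contDiff_polyFun (n := 0) r).continuous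
  have h := (integral_eq_zero_iff_of_nonneg (fun x => mul_self_nonneg (polyFun r x))
    (memLp_one_iff_integrable.1 (hc.memLp_stdSimplex' 1))).1 (hr r hdeg)
  refine eq_of_polyFun_eq ?_
  rw [(analyticOnNhd_polyFun r).eq_zero_of_ae_stdSimplex'
    (h.mono fun x hx => mul_self_eq_zero.1 hx)]
  funext y
  simp [polyFun]

theorem norm_toLp_sq_stdSimplex' {d : ℕ} {G : Type*} [NormedAddCommGroup G]
    {F : EuclideanSpace ℝ (Fin d) → G} (hF : MemLp F 2 (volume.restrict (stdSimplex' d))) :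
    ‖hF.toLp F‖ ^ 2 = ∫ x in stdSimplex' d, ‖F x‖ ^ 2 := by
  have h0 : 0 ≤ ∫ x in stdSimplex' d, ‖F x‖ ^ 2 := integral_nonneg fun x => by positivity
  rw [Lp.norm_toLp, hF.eLpNorm_eq_integral_rpow_norm two_ne_zero ENNReal.ofNat_ne_top,
    ENNReal.toReal_ofReal (by positivity)]
  simp only [ENNReal.toReal_ofNat, Real.rpow_ofNat]
  rw [← one_div, ← Real.sqrt_eq_rpow, Real.sq_sqrt h0]

/-- The `L²` projection onto polynomials of degree at most `ℓ` is stable with respect to the `L²`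
seminorm of a linear differential expression `D` whose kernel consists of polynomials of degree
at most `ℓ`. -/
theorem exists_integral_norm_sq_le {d ℓ L : ℕ} {G : Type*} [NormedAddCommGroup G]
    [NormedSpace ℝ G] (D : MvPolynomial (Fin d) ℝ →ₗ[ℝ] EuclideanSpace ℝ (Fin d) → G)
    (hD : ∀ u, AnalyticOnNhd ℝ (D u) Set.univ) (hker : ∀ u, D u = 0 → u.totalDegree ≤ ℓ) :
    ∃ C : ℝ, 0 < C ∧ ∀ u r : MvPolynomial (Fin d) ℝ, u.totalDegree ≤ L → r.totalDegree ≤ L →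
      (u - r).totalDegree ≤ ℓ → r ∈ simplexOrthogonal d ℓ →
      ∫ x in stdSimplex' d, ‖D r x‖ ^ 2 ≤ C * ∫ x in stdSimplex' d, ‖D u x‖ ^ 2 := by
  have hm (u) : MemLp (D u) 2 (volume.restrict (stdSimplex' d)) :=
    (continuousOn_univ.1 (hD u).continuousOn).memLp_stdSimplex' 2
  let Φ : MvPolynomial (Fin d) ℝ →ₗ[ℝ] Lp G 2 (volume.restrict (stdSimplex' d)) :=
    { toFun := fun u => (hm u).toLp (D u)
      map_add' := fun u v => by
        rw [← MemLp.toLp_add]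
        simp only [map_add]
      map_smul' := fun c u => by
        rw [RingHom.id_apply, ← MemLp.toLp_const_smul]
        simp only [map_smul] }
  let P := (restrictTotalDegree (Fin d) ℝ L).prod (restrictTotalDegree (Fin d) ℝ L)
  let S : Submodule ℝ P :=
    ((restrictTotalDegree (Fin d) ℝ ℓ).comap (LinearMap.fst ℝ _ _ - LinearMap.snd ℝ _ _) ⊓
      (simplexOrthogonal d ℓ).comap (LinearMap.snd ℝ _ _)).comap P.subtype
  have : FiniteDimensional ℝ P :=
    Module.Finite.iff_fg.2 ((Module.Finite.iff_fg.1 inferInstance).prod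
      (Module.Finite.iff_fg.1 inferInstance))
  have : FiniteDimensional ℝ S := FiniteDimensional.finiteDimensional_submodule S
  let f : S →ₗ[ℝ] MvPolynomial (Fin d) ℝ := LinearMap.fst ℝ _ _ ∘ₗ P.subtype ∘ₗ S.subtype
  let g : S →ₗ[ℝ] MvPolynomial (Fin d) ℝ := LinearMap.snd ℝ _ _ ∘ₗ P.subtype ∘ₗ S.subtype
  have hΦ : ∀ z : S, (Φ ∘ₗ f) z = 0 → (Φ ∘ₗ g) z = 0 := by
    rintro ⟨⟨⟨u, r⟩, _⟩, hdiff, horth⟩ h0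
    have hu : u.totalDegree ≤ ℓ := hker u
      ((hD u).eq_zero_of_ae_stdSimplex' ((MemLp.toLp_eq_toLp_iff (hm u) MemLp.zero).1 h0))
    rw [← mem_restrictTotalDegree] at hu
    have hr : r ∈ restrictTotalDegree (Fin d) ℝ ℓ :=
      sub_sub_cancel u r ▸ Submodule.sub_mem _ hu hdiff
    have hr0 : r = 0 := eq_zero_of_mem_simplexOrthogonal horth
      ((mem_restrictTotalDegree _ _ _).1 hr)
    simp [g, hr0]
  obtain ⟨C, hC, hb⟩ := LinearMap.exists_norm_le_of_ker_le (V := S)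
    (E := Lp G 2 (volume.restrict (stdSimplex' d)))
    (F := Lp G 2 (volume.restrict (stdSimplex' d))) (Φ ∘ₗ f) (Φ ∘ₗ g) hΦ
  refine ⟨C ^ 2, by positivity, fun u r hu hr hdiff horth => ?_⟩
  have h := hb ⟨⟨(u, r), (mem_restrictTotalDegree _ _ _).2 hu,
    (mem_restrictTotalDegree _ _ _).2 hr⟩, (mem_restrictTotalDegree _ _ _).2 hdiff, horth⟩
  rw [← norm_toLp_sq_stdSimplex' (hm r), ← norm_toLp_sq_stdSimplex' (hm u), ← mul_pow]
  exact pow_le_pow_left₀ (norm_nonneg _) h 2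

/-- The gradient as a linear map on polynomials. -/
noncomputable def polyGradient (d : ℕ) : MvPolynomial (Fin d) ℝ →ₗ[ℝ]
    EuclideanSpace ℝ (Fin d) → EuclideanSpace ℝ (Fin d) →L[ℝ] ℝ where
  toFun u := fderiv ℝ (polyFun u)
  map_add' u v := by
    funext x
    rw [polyFun_add, fderiv_add ((contDiff_polyFun (n := 1) u).differentiable one_ne_zero x)
      ((contDiff_polyFun (n := 1) v).differentiable one_ne_zero x), Pi.add_apply]
  map_smul' c u := by
    funext x
    rw [polyFun_smul, fderiv_const_smul
      ((contDiff_polyFun (n := 1) u).differentiable one_ne_zero x), RingHom.id_apply,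
      Pi.smul_apply]

/-- The Hessian as a linear map on polynomials. -/
noncomputable def polyHessian (d : ℕ) : MvPolynomial (Fin d) ℝ →ₗ[ℝ]
    EuclideanSpace ℝ (Fin d) → (EuclideanSpace ℝ (Fin d)) [×2]→L[ℝ] ℝ where
  toFun u := iteratedFDeriv ℝ 2 (polyFun u)
  map_add' u v := by
    rw [polyFun_add, iteratedFDeriv_add (contDiff_polyFun u) (contDiff_polyFun v)]
  map_smul' c u := by
    funext x
    rw [polyFun_smul, iteratedFDeriv_const_smul_apply (contDiff_polyFun u).contDiffAt,
      RingHom.id_apply, Pi.smul_apply]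

theorem totalDegree_le_one_of_fderiv_const {d : ℕ} {u : MvPolynomial (Fin d) ℝ}
    {A : EuclideanSpace ℝ (Fin d) →L[ℝ] ℝ} (h : ∀ x, fderiv ℝ (polyFun u) x = A) :
    u.totalDegree ≤ 1 := by
  have hdiff : Differentiable ℝ (polyFun u) :=
    (contDiff_polyFun (n := 1) u).differentiable one_ne_zero
  have hconst (x) : polyFun u x - A x = polyFun u 0 - A 0 := by
    refine is_const_of_fderiv_eq_zero (𝕜 := ℝ) (f := fun x => polyFun u x - A x)
      (hdiff.sub A.differentiable) (fun x => ?_) x 0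
    rw [fderiv_fun_sub (hdiff x) A.differentiableAt, h, A.fderiv, sub_self]
  have hu : u = C (polyFun u 0) + ∑ i, C (A (EuclideanSpace.single i 1)) * X i := by
    refine eq_of_polyFun_eq (funext fun x => ?_)
    have hx : A x = ∑ i, A (EuclideanSpace.single i 1) * x i := by
      conv_lhs => rw [← (EuclideanSpace.basisFun (Fin d) ℝ).sum_repr x]
      simp [mul_comm]
    have h1 : polyFun u x = polyFun u 0 + A x := by
      have := hconst x
      rw [map_zero] at this
      linarith
    rw [h1, hx]
    simp [polyFun]
  rw [hu]
  refine (totalDegree_add _ _).trans (max_le (by simp) (totalDegree_finsetSum_le fun i _ => ?_))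
  exact (totalDegree_mul _ _).trans (by simp)

theorem totalDegree_le_one_of_polyGradient_eq_zero {d : ℕ} {u : MvPolynomial (Fin d) ℝ}
    (h : polyGradient d u = 0) : u.totalDegree ≤ 1 :=
  totalDegree_le_one_of_fderiv_const (A := 0) fun x => congrFun h x

theorem totalDegree_le_one_of_polyHessian_eq_zero {d : ℕ} {u : MvPolynomial (Fin d) ℝ}
    (h : polyHessian d u = 0) : u.totalDegree ≤ 1 := by
  refine totalDegree_le_one_of_fderiv_const (A := fderiv ℝ (polyFun u) 0) fun x => ?_
  refine is_const_of_fderiv_eq_zero (𝕜 := ℝ)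
    (((contDiff_polyFun (n := 2) u).fderiv_right (m := 1) le_rfl).differentiable one_ne_zero)
    (fun y => ?_) x 0
  have hy : iteratedFDeriv ℝ 2 (polyFun u) y = 0 := congrFun h y
  ext v w
  have := iteratedFDeriv_two_apply (𝕜 := ℝ) (polyFun u) y ![v, w]
  simpa [hy] using this.symm

/-- Quasi-optimality of the `L²(T)` projection `Π_ℓ` onto polynomials of degree `≤ ℓ`
with respect to the energy seminorm `|||v|||² = ε²‖D²v‖² + α‖∇v‖²` on the standard
simplex, uniformly in `ε ∈ (0,1]` and `α ∈ {0,1}`: if `p` is the `L²(T)`-orthogonal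
projection of a polynomial `w` of degree `≤ L` (characterized by the orthogonality
relations), then `|||w − p|||_T ≲ |||w − v|||_T` for every polynomial `v` of
degree `≤ ℓ`. -/
theorem L2_projection_quasi_optimal (d ℓ L : ℕ) (hd : 1 ≤ d) (hℓ : 2 ≤ ℓ) (hℓL : ℓ ≤ L) :
    ∃ C : ℝ, 0 < C ∧
      ∀ ε α : ℝ, 0 < ε → ε ≤ 1 → (α = 0 ∨ α = 1) →
      ∀ w p : MvPolynomial (Fin d) ℝ, w.totalDegree ≤ L → p.totalDegree ≤ ℓ →
      (∀ q : MvPolynomial (Fin d) ℝ, q.totalDegree ≤ ℓ →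
        (∫ x in stdSimplex' d,
          (eval (fun i => x i) w - eval (fun i => x i) p) * eval (fun i => x i) q) = 0) →
      ∀ v : MvPolynomial (Fin d) ℝ, v.totalDegree ≤ ℓ →
        ε ^ 2 * (∫ x in stdSimplex' d,
            ‖iteratedFDeriv ℝ 2
              (fun y : EuclideanSpace ℝ (Fin d) => eval (fun i => y i) (w - p)) x‖ ^ 2) +
          α * (∫ x in stdSimplex' d,
            ‖fderiv ℝ
              (fun y : EuclideanSpace ℝ (Fin d) => eval (fun i => y i) (w - p)) x‖ ^ 2) ≤
        C * (ε ^ 2 * (∫ x in stdSimplex' d,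
            ‖iteratedFDeriv ℝ 2
              (fun y : EuclideanSpace ℝ (Fin d) => eval (fun i => y i) (w - v)) x‖ ^ 2) +
          α * (∫ x in stdSimplex' d,
            ‖fderiv ℝ
              (fun y : EuclideanSpace ℝ (Fin d) => eval (fun i => y i) (w - v)) x‖ ^ 2)) := by
  obtain ⟨C₁, hC₁, h₁⟩ := exists_integral_norm_sq_le (ℓ := ℓ) (L := L) (polyGradient d)
    (fun u => (analyticOnNhd_polyFun u).fderiv)
    (fun u hu => (totalDegree_le_one_of_polyGradient_eq_zero hu).trans (by omega))
  obtain ⟨C₂, hC₂, h₂⟩ := exists_integral_norm_sq_le (ℓ := ℓ) (L := L) (polyHessian d)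
    (fun u => (analyticOnNhd_polyFun u).iteratedFDeriv 2)
    (fun u hu => (totalDegree_le_one_of_polyHessian_eq_zero hu).trans (by omega))
  refine ⟨max C₁ C₂, lt_max_of_lt_left hC₁, fun ε α _ _ hα w p hw hp horth v hv => ?_⟩
  have hα0 : 0 ≤ α := by rcases hα with rfl | rfl <;> norm_num
  have hwv : (w - v).totalDegree ≤ L :=
    (totalDegree_sub _ _).trans (max_le hw (hv.trans hℓL))
  have hwp : (w - p).totalDegree ≤ L :=
    (totalDegree_sub _ _).trans (max_le hw (hp.trans hℓL))
  have hdiff : (w - v - (w - p)).totalDegree ≤ ℓ := by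
    rw [sub_sub_sub_cancel_left]
    exact (totalDegree_sub _ _).trans (max_le hp hv)
  have hmem : w - p ∈ simplexOrthogonal d ℓ := fun q hq => by
    simpa [polyFun] using horth q hq
  have hgrad := h₁ _ _ hwv hwp hdiff hmem
  have hhess := h₂ _ _ hwv hwp hdiff hmem
  rw [mul_add, mul_left_comm _ (ε ^ 2), mul_left_comm _ α]
  have hnonneg {G : Type} [NormedAddCommGroup G] (F : EuclideanSpace ℝ (Fin d) → G) :
      0 ≤ ∫ x in stdSimplex' d, ‖F x‖ ^ 2 := integral_nonneg fun x => by positivity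
  refine add_le_add (mul_le_mul_of_nonneg_left (hhess.trans ?_) (sq_nonneg ε))
    (mul_le_mul_of_nonneg_left (hgrad.trans ?_) hα0)
  · exact mul_le_mul_of_nonneg_right (le_max_right _ _) (hnonneg _)
  · exact mul_le_mul_of_nonneg_right (le_max_left _ _) (hnonneg _)
end
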